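/- Let K be a h-convex body in the hyperbolic plane ℍ^2 (the case n = 1). Then there exists a sequence of h-convex polytopes {P_i} with d_H(K, P_i) → 0 as i → ∞; equivalently, for every ε > 0 there exists a h-convex polytope P_ε with P_ε ⊂ K ⊂ (P_ε)^ε, so that d_H(K, P_ε) ≤ ε. -/

import Mathlib

noncomputable section

open Real MeasureTheory Filter Topology Set
open scoped ENNReal symmDiff

namespace Horo

/-- The Lorentzian inner product on ℝ^{n+2}:
`X·Y = Σ_{i=1}^{n+1} x_i y_i − x_{n+2} y_{n+2}`. -/
def lprod (n : ℕ) (X Y : Fin (n + 2) → ℝ) : ℝ :=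
  (∑ i : Fin (n + 1), X i.castSucc * Y i.castSucc) - X (Fin.last (n + 1)) * Y (Fin.last (n + 1))

/-- The hyperboloid model ℍ^{n+1} of hyperbolic space. -/
def Hyp (n : ℕ) : Set (Fin (n + 2) → ℝ) :=
  {X | lprod n X X = -1 ∧ 0 < X (Fin.last (n + 1))}

/-- The origin O = (0,…,0,1) of hyperbolic space. -/
def origin (n : ℕ) : Fin (n + 2) → ℝ := Fin.snoc (fun _ => 0) 1

/-- The unit sphere 𝕊^n ⊂ ℝ^{n+1}. -/
def sph (n : ℕ) : Set (Fin (n + 1) → ℝ) := {e | ∑ i, e i ^ 2 = 1}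

/-- The null vector (e,1) ∈ ℝ^{n+2} associated with e ∈ 𝕊^n. -/
def dir {n : ℕ} (e : Fin (n + 1) → ℝ) : Fin (n + 2) → ℝ := Fin.snoc e 1

/-- The geodesic distance d(X,Y) = arcosh(−X·Y) on the hyperboloid. -/
def dH (n : ℕ) (X Y : Fin (n + 2) → ℝ) : ℝ :=
  Real.log (-(lprod n X Y) + Real.sqrt ((lprod n X Y) ^ 2 - 1))

/-- The horosphere H_e(s) = {X ∈ ℍ^{n+1} : X·(e,1) = −e^s}. -/
def horoSphere (n : ℕ) (e : Fin (n + 1) → ℝ) (s : ℝ) : Set (Fin (n + 2) → ℝ) :=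
  {X ∈ Hyp n | lprod n X (dir e) = -Real.exp s}

/-- The open horo-ball B_e(s) = {X ∈ ℍ^{n+1} : 0 > X·(e,1) > −e^s}. -/
def horoBall (n : ℕ) (e : Fin (n + 1) → ℝ) (s : ℝ) : Set (Fin (n + 2) → ℝ) :=
  {X ∈ Hyp n | 0 > lprod n X (dir e) ∧ lprod n X (dir e) > -Real.exp s}

/-- The closed horo-ball B̄_e(s) = {X ∈ ℍ^{n+1} : 0 > X·(e,1) ≥ −e^s}. -/
def horoBallCl (n : ℕ) (e : Fin (n + 1) → ℝ) (s : ℝ) : Set (Fin (n + 2) → ℝ) :=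
  {X ∈ Hyp n | 0 > lprod n X (dir e) ∧ lprod n X (dir e) ≥ -Real.exp s}

/-- A set Ω ⊂ ℍ^{n+1} is horospherically convex (h-convex) if it is closed and every
relative boundary point of Ω admits a supporting horo-ball. -/
def IsHConvex (n : ℕ) (Ω : Set (Fin (n + 2) → ℝ)) : Prop :=
  Ω ⊆ Hyp n ∧ IsClosed Ω ∧
    ∀ X ∈ Ω ∩ closure (Hyp n \ Ω),
      ∃ e ∈ sph n, ∃ s : ℝ, Ω ⊆ horoBallCl n e s ∧ X ∈ horoSphere n e s

/-- The interior of a subset of the hyperboloid, relative to the hyperboloid. -/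
def relInt (n : ℕ) (K : Set (Fin (n + 2) → ℝ)) : Set (Fin (n + 2) → ℝ) :=
  {X ∈ Hyp n | ∃ ε > 0, ∀ Y ∈ Hyp n, dH n X Y < ε → Y ∈ K}

/-- A h-convex body: a compact h-convex set with nonempty (relative) interior. -/
def IsHConvexBody (n : ℕ) (K : Set (Fin (n + 2) → ℝ)) : Prop :=
  IsHConvex n K ∧ IsCompact K ∧ (relInt n K).Nonempty

/-- A h-convex polytope: a h-convex body which is a finite intersection of closed
horo-balls. -/
def IsHPolytope (n : ℕ) (P : Set (Fin (n + 2) → ℝ)) : Prop :=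
  IsHConvexBody n P ∧ ∃ m : ℕ, 2 ≤ m ∧ ∃ (e : Fin m → (Fin (n + 1) → ℝ)) (u : Fin m → ℝ),
    (∀ i, e i ∈ sph n) ∧ P = ⋂ i, horoBallCl n (e i) (u i)

/-- The horospherical support function u(K,e) = sup{log(−X·(e,1)) : X ∈ K}. -/
def suppFn (n : ℕ) (K : Set (Fin (n + 2) → ℝ)) (e : Fin (n + 1) → ℝ) : ℝ :=
  sSup ((fun X => Real.log (-(lprod n X (dir e)))) '' K)

/-- The outer parallel set K^ε = {X ∈ ℍ^{n+1} : d(K,X) ≤ ε}. -/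
def outPar (n : ℕ) (K : Set (Fin (n + 2) → ℝ)) (ε : ℝ) : Set (Fin (n + 2) → ℝ) :=
  {X ∈ Hyp n | ∃ Y ∈ K, dH n Y X ≤ ε}

/-- The Hausdorff distance d_H(K,L) = inf{ε ≥ 0 : K ⊆ L^ε and L ⊆ K^ε}. -/
def dHaus (n : ℕ) (K L : Set (Fin (n + 2) → ℝ)) : ℝ :=
  sInf {ε : ℝ | 0 ≤ ε ∧ K ⊆ outPar n L ε ∧ L ⊆ outPar n K ε}

/-- The point (sinh r · θ, cosh r) ∈ ℍ^{n+1} at distance r from O in direction θ. -/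
def rpt (n : ℕ) (θ : Fin (n + 1) → ℝ) (r : ℝ) : Fin (n + 2) → ℝ :=
  Fin.snoc (fun i => Real.sinh r * θ i) (Real.cosh r)

/-- The radial function ρ(K,θ) = max{λ ≥ 0 : (sinh λ · θ, cosh λ) ∈ K}. -/
def radFn (n : ℕ) (K : Set (Fin (n + 2) → ℝ)) (θ : Fin (n + 1) → ℝ) : ℝ :=
  sSup {r : ℝ | 0 ≤ r ∧ rpt n θ r ∈ K}

/-- R(K) = max_θ ρ(K,θ). -/
def Rmax (n : ℕ) (K : Set (Fin (n + 2) → ℝ)) : ℝ := sSup (radFn n K '' sph n)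

/-- r(K) = min_θ ρ(K,θ). -/
def rmin (n : ℕ) (K : Set (Fin (n + 2) → ℝ)) : ℝ := sInf (radFn n K '' sph n)

/-- The point reflection (x_1,…,x_{n+1},x_{n+2}) ↦ (−x_1,…,−x_{n+1},x_{n+2}) about O. -/
def symMap (n : ℕ) (X : Fin (n + 2) → ℝ) : Fin (n + 2) → ℝ :=
  fun i => if i = Fin.last (n + 1) then X i else -X i

/-- The hyperbolic (Riemannian) volume of a subset of the hyperboloid, computed via the
graph parametrization x ↦ (x, √(1+|x|²)), whose volume density is 1/√(1+|x|²). -/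
def hypVol (n : ℕ) (K : Set (Fin (n + 2) → ℝ)) : ℝ :=
  ∫ x : Fin (n + 1) → ℝ,
    Set.indicator {y : Fin (n + 1) → ℝ | Fin.snoc y (Real.sqrt (1 + ∑ i, y i ^ 2)) ∈ K}
      (fun y => 1 / Real.sqrt (1 + ∑ i, y i ^ 2)) x

/-- The distance from a point X to a set P. -/
def distTo (n : ℕ) (P : Set (Fin (n + 2) → ℝ)) (X : Fin (n + 2) → ℝ) : ℝ :=
  sInf ((fun Y => dH n Y X) '' P)

/-- The facet F(P,e) = P ∩ H_e(u(P,e)). -/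
def facet (n : ℕ) (P : Set (Fin (n + 2) → ℝ)) (e : Fin (n + 1) → ℝ) :
    Set (Fin (n + 2) → ℝ) :=
  P ∩ horoSphere n e (suppFn n P e)

/-- The relative interior of the facet F(P,e) inside the horosphere H_e(u(P,e)). -/
def facetRelInt (n : ℕ) (P : Set (Fin (n + 2) → ℝ)) (e : Fin (n + 1) → ℝ) :
    Set (Fin (n + 2) → ℝ) :=
  {Y ∈ facet n P e | ∃ δ > 0, ∀ Z ∈ horoSphere n e (suppFn n P e),
    dH n Y Z < δ → Z ∈ facet n P e}

/-- The collar 𝒫_t(P, F̊(P,e)): points at positive distance ≤ t from P whose nearest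
point in P lies in the relative interior of the facet F(P,e). -/
def collar (n : ℕ) (P : Set (Fin (n + 2) → ℝ)) (e : Fin (n + 1) → ℝ) (t : ℝ) :
    Set (Fin (n + 2) → ℝ) :=
  {X ∈ Hyp n | 0 < distTo n P X ∧ distTo n P X ≤ t ∧
    ∃ Y ∈ facetRelInt n P e, ∀ Z ∈ P, dH n Y X ≤ dH n Z X}

/-- The diameter of a set with respect to a distance function, in ℝ≥0∞. -/
def ediamWith {α : Type*} (d : α → α → ℝ) (U : Set α) : ℝ≥0∞ :=
  ⨆ (x ∈ U) (y ∈ U), ENNReal.ofReal (d x y)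

/-- The (unnormalized) s-dimensional Hausdorff measure associated with a distance
function d, via the Carathéodory construction. -/
def hMeasWith {α : Type*} (d : α → α → ℝ) (s : ℕ) (A : Set α) : ℝ≥0∞ :=
  ⨆ (δ : ℝ) (_ : 0 < δ),
    ⨅ (U : ℕ → Set α) (_ : A ⊆ ⋃ i, U i) (_ : ∀ i, ediamWith d (U i) ≤ ENNReal.ofReal δ),
      ∑' i, ediamWith d (U i) ^ s

/-- ω_n, the volume of the unit ball in ℝ^n. -/
def unitBallVol (n : ℕ) : ℝ :=
  (volume (Metric.ball (0 : EuclideanSpace ℝ (Fin n)) 1)).toReal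

/-- S(P,e): the n-dimensional area of the facet F(P,e), i.e. the normalized
n-dimensional Hausdorff measure of F(P,e) with respect to the hyperbolic distance. -/
def areaFacet (n : ℕ) (P : Set (Fin (n + 2) → ℝ)) (e : Fin (n + 1) → ℝ) : ℝ :=
  (ENNReal.ofReal (unitBallVol n / 2 ^ n) * hMeasWith (dH n) n (facet n P e)).toReal


theorem lprod_one (X Y : Fin 3 → ℝ) :
    lprod 1 X Y = X 0 * Y 0 + X 1 * Y 1 - X 2 * Y 2 := by
  rw [lprod, Fin.sum_univ_two]
  rfl

theorem lprod_one_dir (X : Fin 3 → ℝ) (e : Fin 2 → ℝ) :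
    lprod 1 X (dir e) = X 0 * e 0 + X 1 * e 1 - X 2 := by
  have h0 : (dir e : Fin 3 → ℝ) 0 = e 0 := rfl
  have h1 : (dir e : Fin 3 → ℝ) 1 = e 1 := rfl
  have h2 : (dir e : Fin 3 → ℝ) 2 = 1 := rfl
  rw [lprod_one, h0, h1, h2, mul_one]

theorem mem_Hyp_one {X : Fin 3 → ℝ} :
    X ∈ Hyp 1 ↔ X 0 ^ 2 + X 1 ^ 2 + 1 = X 2 ^ 2 ∧ 0 < X 2 := by
  have : X ∈ Hyp 1 ↔ lprod 1 X X = -1 ∧ 0 < X 2 := Iff.rfl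
  rw [this, lprod_one]
  refine and_congr_left fun _ => ⟨fun h => by linarith, fun h => by linarith⟩

theorem mem_sph_one {e : Fin 2 → ℝ} : e ∈ sph 1 ↔ e 0 ^ 2 + e 1 ^ 2 = 1 := by
  have : e ∈ sph 1 ↔ ∑ i, e i ^ 2 = 1 := Iff.rfl
  rw [this, Fin.sum_univ_two]

theorem lprod_dir_neg {X : Fin 3 → ℝ} (hX : X ∈ Hyp 1) {e : Fin 2 → ℝ} (he : e ∈ sph 1) :
    lprod 1 X (dir e) < 0 := by
  rw [mem_Hyp_one] at hX
  rw [mem_sph_one] at he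
  rw [lprod_one_dir]
  have : (X 0 * e 0 + X 1 * e 1) ^ 2 < X 2 ^ 2 := by
    have h : (X 0 * e 0 + X 1 * e 1) ^ 2 + (X 0 * e 1 - X 1 * e 0) ^ 2
        = (X 0 ^ 2 + X 1 ^ 2) * (e 0 ^ 2 + e 1 ^ 2) := by ring
    rw [he] at h
    nlinarith [sq_nonneg (X 0 * e 1 - X 1 * e 0)]
  linarith [lt_of_pow_lt_pow_left₀ 2 hX.2.le this]

theorem mem_horoBallCl_one {X : Fin 3 → ℝ} {e : Fin 2 → ℝ} (he : e ∈ sph 1) {s : ℝ} :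
    X ∈ horoBallCl 1 e s ↔ X ∈ Hyp 1 ∧ -lprod 1 X (dir e) ≤ Real.exp s :=
  ⟨fun h => ⟨h.1, by linarith [h.2.2]⟩,
    fun h => ⟨h.1, lprod_dir_neg h.1 he, by linarith [h.2]⟩⟩

theorem one_le_neg_lprod {X Y : Fin 3 → ℝ} (hX : X ∈ Hyp 1) (hY : Y ∈ Hyp 1) :
    1 ≤ -lprod 1 X Y := by
  rw [mem_Hyp_one] at hX hY
  rw [lprod_one]
  have : (X 0 * Y 0 + X 1 * Y 1 + 1) ^ 2 ≤ (X 2 * Y 2) ^ 2 := by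
    rw [mul_pow, ← hX.1, ← hY.1]
    nlinarith [sq_nonneg (X 0 * Y 1 - X 1 * Y 0), sq_nonneg (X 0 - Y 0), sq_nonneg (X 1 - Y 1)]
  have := le_of_sq_le_sq this (mul_pos hX.2 hY.2).le
  linarith

theorem lprod_self {X : Fin 3 → ℝ} (hX : X ∈ Hyp 1) : lprod 1 X X = -1 := hX.1

theorem dH_self {X : Fin 3 → ℝ} (hX : X ∈ Hyp 1) : dH 1 X X = 0 := by
  simp [dH, lprod_self hX]

theorem continuous_lprod_one : Continuous fun p : (Fin 3 → ℝ) × (Fin 3 → ℝ) => lprod 1 p.1 p.2 := by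
  simp only [lprod_one]
  fun_prop

theorem continuous_lprod_dir (e : Fin 2 → ℝ) :
    Continuous fun X : Fin 3 → ℝ => lprod 1 X (dir e) := by
  simp only [lprod_one_dir]
  fun_prop

/-- Horospherical height is Lipschitz: `g_e(Y) ≤ exp (d(X,Y)) g_e(X)`, `g_e = -⟨·,(e,1)⟩`. -/
theorem neg_lprod_dir_le {X Y : Fin 3 → ℝ} (hX : X ∈ Hyp 1) (hY : Y ∈ Hyp 1)
    {e : Fin 2 → ℝ} (he : e ∈ sph 1) :
    -lprod 1 Y (dir e) ≤ Real.exp (dH 1 X Y) * -lprod 1 X (dir e) := by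
  have hp := lprod_dir_neg hX he
  have hc := one_le_neg_lprod hX hY
  have hs0 : 0 ≤ √((lprod 1 X Y) ^ 2 - 1) := Real.sqrt_nonneg _
  have hs : √((lprod 1 X Y) ^ 2 - 1) ^ 2 = (lprod 1 X Y) ^ 2 - 1 :=
    Real.sq_sqrt (by nlinarith)
  rw [dH, Real.exp_log (by linarith)]
  set r := √((lprod 1 X Y) ^ 2 - 1)
  have gram : (lprod 1 Y (dir e)) ^ 2 + (lprod 1 X (dir e)) ^ 2
      + 2 * lprod 1 X Y * lprod 1 X (dir e) * lprod 1 Y (dir e) ≤ 0 := by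
    rw [mem_Hyp_one] at hX hY
    rw [mem_sph_one] at he
    rw [lprod_one_dir, lprod_one_dir, lprod_one]
    have key : ∀ x y z a b c u v : ℝ, x ^ 2 + y ^ 2 + 1 = z ^ 2 → a ^ 2 + b ^ 2 + 1 = c ^ 2 →
        u ^ 2 + v ^ 2 = 1 → (a * u + b * v - c) ^ 2 + (x * u + y * v - z) ^ 2
          + 2 * (x * a + y * b - z * c) * (x * u + y * v - z) * (a * u + b * v - c)
          = -(x * (b - c * v) - y * (a - c * u) + z * (a * v - b * u)) ^ 2 := by
      intro x y z a b c u v h1 h2 h3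
      have e1 : (a * u + b * v - c) ^ 2 = (a * u + b * v - c) ^ 2 * (z ^ 2 - x ^ 2 - y ^ 2) := by
        rw [← h1]; ring
      have e2 : (x * u + y * v - z) ^ 2 = (x * u + y * v - z) ^ 2 * (c ^ 2 - a ^ 2 - b ^ 2) := by
        rw [← h2]; ring
      have e3 : u ^ 2 = 1 - v ^ 2 := by linarith
      rw [e1, e2]
      linear_combination ((x * a + y * b - z * c) ^ 2
        - (z ^ 2 - x ^ 2 - y ^ 2) * (c ^ 2 - a ^ 2 - b ^ 2)) * h3
    rw [key _ _ _ _ _ _ _ _ hX.1 hY.1 he]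
    exact neg_nonpos.2 (sq_nonneg _)
  have h2 : (-lprod 1 Y (dir e) + lprod 1 X Y * -lprod 1 X (dir e)) ^ 2
      ≤ (r * -lprod 1 X (dir e)) ^ 2 := by
    rw [mul_pow, hs]
    nlinarith
  have := le_of_sq_le_sq h2 (mul_nonneg hs0 (by linarith))
  linarith

/-- The point at distance `r` from `X` on the geodesic ray issuing from the ideal point `e`
through `X`. -/
theorem exists_neg_lprod_dir_eq {X : Fin 3 → ℝ} (hX : X ∈ Hyp 1) {e : Fin 2 → ℝ}
    (he : e ∈ sph 1) {r : ℝ} (hr : 0 ≤ r) :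
    ∃ Y ∈ Hyp 1, dH 1 X Y = r ∧ -lprod 1 Y (dir e) = Real.exp r * -lprod 1 X (dir e) := by
  have hg := lprod_dir_neg hX he
  have ha : 1 ≤ Real.exp r := Real.one_le_exp hr
  have hlog : Real.log (Real.exp r) = r := Real.log_exp r
  generalize Real.exp r = a at *
  obtain ⟨b, hb⟩ : ∃ b, 2 * a * b * -lprod 1 X (dir e) = a ^ 2 - 1 :=
    ⟨(a ^ 2 - 1) / (2 * a * -lprod 1 X (dir e)), by
      have : lprod 1 X (dir e) ≠ 0 := hg.ne
      have : a ≠ 0 := by linarith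
      field_simp⟩
  have hN : lprod 1 (dir e) (dir e) = 0 := by
    rw [mem_sph_one] at he
    rw [lprod_one_dir]
    change e 0 * e 0 + e 1 * e 1 - 1 = 0
    linarith
  have hxx := lprod_self hX
  have hYN : lprod 1 (a • X - b • dir e) (dir e)
      = a * lprod 1 X (dir e) - b * lprod 1 (dir e) (dir e) := by
    simp only [lprod_one, Pi.sub_apply, Pi.smul_apply, smul_eq_mul]
    ring
  have hXY : lprod 1 X (a • X - b • dir e) = a * lprod 1 X X - b * lprod 1 X (dir e) := by
    simp only [lprod_one, Pi.sub_apply, Pi.smul_apply, smul_eq_mul]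
    ring
  have hYY : lprod 1 (a • X - b • dir e) (a • X - b • dir e)
      = a ^ 2 * lprod 1 X X - 2 * a * b * lprod 1 X (dir e)
        + b ^ 2 * lprod 1 (dir e) (dir e) := by
    simp only [lprod_one, Pi.sub_apply, Pi.smul_apply, smul_eq_mul]
    ring
  have hpos : 0 < (a • X - b • dir e : Fin 3 → ℝ) 2 := by
    change 0 < a * X 2 - b * 1
    rw [mem_Hyp_one] at hX
    rw [mem_sph_one] at he
    have h1 : 1 ≤ 2 * -lprod 1 X (dir e) * X 2 := by
      rw [lprod_one_dir]
      have : X 2 ^ 2 * (e 0 ^ 2 + e 1 ^ 2) = X 2 ^ 2 := by rw [he, mul_one]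
      nlinarith [sq_nonneg (X 0 - X 2 * e 0), sq_nonneg (X 1 - X 2 * e 1)]
    have h2 : 0 < (2 * a * -lprod 1 X (dir e)) * (a * X 2 - b * 1) := by nlinarith
    exact (pos_iff_pos_of_mul_pos h2).1 (mul_pos (by linarith) (by linarith))
  refine ⟨a • X - b • dir e, ⟨by rw [hYY, hxx, hN]; linarith, hpos⟩, ?_, ?_⟩
  · have h1 : a * lprod 1 X (a • X - b • dir e) = -(a ^ 2 + 1) / 2 := by
      rw [hXY, hxx]; linarith
    have h2 : lprod 1 X (a • X - b • dir e) = -((a + a⁻¹) / 2) := by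
      have : a ≠ 0 := by linarith
      field_simp
      linarith
    have h3 : (-((a + a⁻¹) / 2)) ^ 2 - 1 = ((a - a⁻¹) / 2) ^ 2 := by
      have : a ≠ 0 := by linarith
      field_simp
      ring
    have h4 : a⁻¹ ≤ 1 := inv_le_one_of_one_le₀ ha
    rw [dH, h2, h3, Real.sqrt_sq (by linarith), ← hlog]
    ring_nf
  · rw [hYN, hN]; ring

/-- The radial projection to the hyperboloid of the affine segment from `X` to `Y`. -/
def geo (X Y : Fin 3 → ℝ) (t : ℝ) : Fin 3 → ℝ :=
  (√(-lprod 1 ((1 - t) • X + t • Y) ((1 - t) • X + t • Y)))⁻¹ • ((1 - t) • X + t • Y)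

theorem one_le_neg_lprod_segment {X Y : Fin 3 → ℝ} (hX : X ∈ Hyp 1) (hY : Y ∈ Hyp 1) {t : ℝ}
    (h0 : 0 ≤ t) (h1 : t ≤ 1) :
    1 ≤ -lprod 1 ((1 - t) • X + t • Y) ((1 - t) • X + t • Y) := by
  have hc := one_le_neg_lprod hX hY
  have hx := lprod_self hX
  have hy := lprod_self hY
  have : lprod 1 ((1 - t) • X + t • Y) ((1 - t) • X + t • Y)
      = (1 - t) ^ 2 * lprod 1 X X + t ^ 2 * lprod 1 Y Y + 2 * ((1 - t) * t) * lprod 1 X Y := by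
    simp only [lprod_one, Pi.add_apply, Pi.smul_apply, smul_eq_mul]
    ring
  rw [this, hx, hy]
  nlinarith [mul_nonneg (sub_nonneg.2 h1) h0]

theorem geo_mem_Hyp {X Y : Fin 3 → ℝ} (hX : X ∈ Hyp 1) (hY : Y ∈ Hyp 1) {t : ℝ}
    (h0 : 0 ≤ t) (h1 : t ≤ 1) : geo X Y t ∈ Hyp 1 := by
  have hD := one_le_neg_lprod_segment hX hY h0 h1
  have hp : 0 < ((1 - t) • X + t • Y) 2 := by
    have hx := (mem_Hyp_one.1 hX).2
    have hy := (mem_Hyp_one.1 hY).2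
    simp only [Pi.add_apply, Pi.smul_apply, smul_eq_mul]
    rcases h0.eq_or_lt with rfl | h0
    · simpa using hx
    · exact add_pos_of_nonneg_of_pos (mul_nonneg (by linarith) hx.le) (mul_pos h0 hy)
  rw [geo]
  set W := (1 - t) • X + t • Y
  have hs : 0 < √(-lprod 1 W W) := Real.sqrt_pos.2 (by linarith)
  refine ⟨?_, mul_pos (inv_pos.2 hs) hp⟩
  have : lprod 1 ((√(-lprod 1 W W))⁻¹ • W) ((√(-lprod 1 W W))⁻¹ • W)
      = lprod 1 W W / √(-lprod 1 W W) ^ 2 := by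
    generalize √(-lprod 1 W W) = k
    simp only [lprod_one, Pi.smul_apply, smul_eq_mul]
    ring
  rw [this, Real.sq_sqrt (by linarith), div_neg, div_self (by linarith)]

/-- Horospherical height is convex along geodesics, in the affine parameter. -/
theorem neg_lprod_dir_geo_le {X Y : Fin 3 → ℝ} (hX : X ∈ Hyp 1) (hY : Y ∈ Hyp 1) {t : ℝ}
    (h0 : 0 ≤ t) (h1 : t ≤ 1) {e : Fin 2 → ℝ} (he : e ∈ sph 1) :
    -lprod 1 (geo X Y t) (dir e)
      ≤ (1 - t) * -lprod 1 X (dir e) + t * -lprod 1 Y (dir e) := by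
  have hs := Real.one_le_sqrt.2 (one_le_neg_lprod_segment hX hY h0 h1)
  have hx := lprod_dir_neg hX he
  have hy := lprod_dir_neg hY he
  rw [geo]
  generalize √(-lprod 1 ((1 - t) • X + t • Y) ((1 - t) • X + t • Y)) = k at hs
  have : -lprod 1 (k⁻¹ • ((1 - t) • X + t • Y)) (dir e)
      = k⁻¹ * ((1 - t) * -lprod 1 X (dir e) + t * -lprod 1 Y (dir e)) := by
    simp only [lprod_one, Pi.add_apply, Pi.smul_apply, smul_eq_mul]
    ring
  rw [this]
  exact mul_le_of_le_one_left (add_nonneg (mul_nonneg (by linarith) (by linarith))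
    (mul_nonneg h0 (by linarith))) (inv_le_one_of_one_le₀ hs)

theorem dH_geo_le {X Y : Fin 3 → ℝ} (hX : X ∈ Hyp 1) (hY : Y ∈ Hyp 1) {t : ℝ}
    (h0 : 0 ≤ t) (h1 : t ≤ 1) : dH 1 (geo X Y t) X ≤ 2 * t * -lprod 1 X Y := by
  have hc := one_le_neg_lprod hX hY
  have hk := one_le_neg_lprod (geo_mem_Hyp hX hY h0 h1) hX
  have hD := one_le_neg_lprod_segment hX hY h0 h1
  have hs := Real.one_le_sqrt.2 hD
  have hsq := Real.sq_sqrt (zero_le_one.trans hD)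
  have hDexp : -lprod 1 ((1 - t) • X + t • Y) ((1 - t) • X + t • Y)
      = (1 - t) ^ 2 + t ^ 2 + 2 * ((1 - t) * t) * -lprod 1 X Y := by
    have hx := lprod_self hX
    have hy := lprod_self hY
    rw [lprod_one] at hx hy
    simp only [lprod_one, Pi.add_apply, Pi.smul_apply, smul_eq_mul]
    linear_combination -(1 - t) ^ 2 * hx - t ^ 2 * hy
  have hgeo : -lprod 1 (geo X Y t) X
      = ((1 - t) + t * -lprod 1 X Y) / √(-lprod 1 ((1 - t) • X + t • Y) ((1 - t) • X + t • Y)) := by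
    have hx := lprod_self hX
    rw [geo]
    generalize √(-lprod 1 ((1 - t) • X + t • Y) ((1 - t) • X + t • Y)) = k
    rw [lprod_one] at hx
    rw [div_eq_inv_mul]
    simp only [lprod_one, Pi.add_apply, Pi.smul_apply, smul_eq_mul]
    linear_combination -k⁻¹ * (1 - t) * hx
  generalize √(-lprod 1 ((1 - t) • X + t • Y) ((1 - t) • X + t • Y)) = k at *
  rw [hDexp] at hsq hD
  rw [dH]
  rw [← neg_sq (lprod 1 (geo X Y t) X)]
  generalize -lprod 1 (geo X Y t) X = m at *
  generalize -lprod 1 X Y = c at *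
  have htc : 0 ≤ t * c := mul_nonneg h0 (by linarith)
  have hm : m ≤ 1 + t * c := by
    rw [hgeo]
    refine (div_le_self (by nlinarith) hs).trans (by linarith)
  have hm2 : m ^ 2 - 1 ≤ (t * c) ^ 2 := by
    have : m ^ 2 - 1 = (t ^ 2 * (c ^ 2 - 1)) / k ^ 2 := by
      rw [hgeo]
      have : k ≠ 0 := by linarith
      field_simp
      rw [hsq]
      ring
    rw [this, hsq]
    refine (div_le_self (mul_nonneg (sq_nonneg _) (by nlinarith)) hD).trans ?_
    nlinarith [sq_nonneg t]
  have hr : √(m ^ 2 - 1) ≤ t * c := Real.sqrt_le_iff.2 ⟨htc, hm2⟩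
  have hr0 := Real.sqrt_nonneg (m ^ 2 - 1)
  have := Real.log_le_sub_one_of_pos (show 0 < m + √(m ^ 2 - 1) by linarith)
  linarith

theorem continuous_geo {X Y : Fin 3 → ℝ} (hX : X ∈ Hyp 1) (hY : Y ∈ Hyp 1) :
    Continuous fun t : unitInterval => geo X Y t := by
  have hW : Continuous fun t : unitInterval => (1 - (t : ℝ)) • X + (t : ℝ) • Y := by fun_prop
  have hs := (continuous_lprod_one.comp (hW.prodMk hW)).neg.sqrt
  exact (hs.inv₀ fun t => (Real.sqrt_pos.2 (zero_lt_one.trans_le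
    (one_le_neg_lprod_segment hX hY t.2.1 t.2.2))).ne').smul hW

theorem geo_zero {X Y : Fin 3 → ℝ} (hX : X ∈ Hyp 1) : geo X Y 0 = X := by
  simp [geo, lprod_self hX]

theorem geo_one {X Y : Fin 3 → ℝ} (hY : Y ∈ Hyp 1) : geo X Y 1 = Y := by
  simp [geo, lprod_self hY]

/-- A geodesic from a point of a closed set to a point outside meets the boundary. -/
theorem exists_geo_mem_boundary {K : Set (Fin 3 → ℝ)} (hK : IsClosed K) {X Y : Fin 3 → ℝ}
    (hX : X ∈ Hyp 1) (hY : Y ∈ Hyp 1) (hXK : X ∈ K) (hYK : Y ∉ K) :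
    ∃ t : unitInterval, geo X Y t ∈ K ∩ closure (Hyp 1 \ K) := by
  have hc := continuous_geo hX hY
  have hne : (frontier ((fun t : unitInterval => geo X Y t) ⁻¹' K)).Nonempty := by
    rw [nonempty_frontier_iff]
    refine ⟨⟨0, by simpa [geo_zero hX] using hXK⟩, fun h => hYK ?_⟩
    have : (1 : unitInterval) ∈ (fun t : unitInterval => geo X Y t) ⁻¹' K := h ▸ mem_univ _
    simpa [geo_one hY] using this
  obtain ⟨t, ht⟩ := hne
  refine ⟨t, (hK.preimage hc).frontier_subset ht, ?_⟩
  rw [frontier_eq_closure_inter_closure] at ht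
  exact map_mem_closure (f := fun t : unitInterval => geo X Y t) hc ht.2 fun u hu => ⟨geo_mem_Hyp hX hY u.2.1 u.2.2, hu⟩

/-- Every h-convex body in the hyperbolic plane ℍ² can be approximated by h-convex
polytopes: for every `ε > 0` there is a h-convex polytope `P` with `P ⊆ K ⊆ P^ε`, so
that `d_H(K,P) ≤ ε`. -/
theorem polytope_approximation_dim2
    (K : Set (Fin 3 → ℝ)) (hK : IsHConvexBody 1 K) (ε : ℝ) (hε : 0 < ε) :
    ∃ P : Set (Fin 3 → ℝ), IsHPolytope 1 P ∧ P ⊆ K ∧ K ⊆ outPar 1 P ε ∧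
      dHaus 1 K P ≤ ε := by
  obtain ⟨⟨hKH, hKc, hsupp⟩, hKcomp, C, hC, η, hη, hball⟩ := hK
  have hCK : C ∈ K := hball C hC (by rwa [dH_self hC])
  set q := Real.exp (-(η / 2)) with hq
  have hq0 : 0 < q := Real.exp_pos _
  have hq1 : q < 1 := Real.exp_lt_one_iff.2 (by linarith)
  have hCq : ∀ e ∈ sph 1, ∀ s, K ⊆ horoBallCl 1 e s →
      -lprod 1 C (dir e) ≤ q * Real.exp s := by
    intro e he s hs
    obtain ⟨Y, hY, hd, hg⟩ := exists_neg_lprod_dir_eq hC he (half_pos hη).le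
    have h := ((mem_horoBallCl_one he).1 (hs (hball Y hY (by linarith)))).2
    rw [hg] at h
    have h' := mul_le_mul_of_nonneg_left h hq0.le
    rwa [← mul_assoc, hq, ← Real.exp_add, neg_add_cancel, Real.exp_zero, one_mul] at h'
  obtain ⟨B, hB⟩ : ∃ B, ∀ X ∈ K, -lprod 1 X C ≤ B := by
    have hcont : Continuous fun X : Fin 3 → ℝ => -lprod 1 X C :=
      (continuous_lprod_one.comp (by fun_prop : Continuous fun X : Fin 3 → ℝ => (X, C))).neg
    obtain ⟨B, hB⟩ := hKcomp.bddAbove_image hcont.continuousOn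
    exact ⟨B, fun X hX => hB (mem_image_of_mem _ hX)⟩
  have hB1 : 1 ≤ B := (one_le_neg_lprod hC hC).trans (hB C hCK)
  obtain ⟨t, ht0, ht1, htB⟩ : ∃ t : ℝ, 0 < t ∧ t < 1 ∧ 2 * t * B ≤ ε := by
    refine ⟨min (1 / 2) (ε / (2 * B)), by positivity,
      (min_le_left _ _).trans_lt (by norm_num), ?_⟩
    have h := (le_div_iff₀ (by positivity)).1 (min_le_right (1 / 2) (ε / (2 * B)))
    linarith
  obtain ⟨ρ, hρ⟩ : ∃ ρ, ρ = (1 - t) * 1 + t * q := ⟨_, rfl⟩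
  have hqρ : q < ρ := by nlinarith
  have hρ1 : ρ < 1 := by nlinarith
  have hρ0 : 0 < ρ := hq0.trans hqρ
  -- finitely many shrunk supporting horo-balls exclude the boundary of `K`
  obtain ⟨L, hL2, hL, hLcov⟩ : ∃ L : List ((Fin 2 → ℝ) × ℝ), 2 ≤ L.length ∧
      (∀ p ∈ L, p.1 ∈ sph 1 ∧ K ⊆ horoBallCl 1 p.1 p.2) ∧
      ∀ Z ∈ K ∩ closure (Hyp 1 \ K), ∃ p ∈ L, ρ * Real.exp p.2 < -lprod 1 Z (dir p.1) := by
    choose! e he s hs hZ using hsupp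
    obtain ⟨T, hT, hcov⟩ := (hKcomp.inter_right isClosed_closure).elim_nhds_subcover
      (fun Z => {X : Fin 3 → ℝ | ρ * Real.exp (s Z) < -lprod 1 X (dir (e Z))}) fun Z hZb => by
        refine (isOpen_lt continuous_const (continuous_lprod_dir (e Z)).neg).mem_nhds ?_
        have h : lprod 1 Z (dir (e Z)) = -Real.exp (s Z) := (hZ Z hZb).2
        change ρ * Real.exp (s Z) < -lprod 1 Z (dir (e Z))
        rw [h, neg_neg]
        exact mul_lt_of_lt_one_left (Real.exp_pos _) hρ1
    have he₀ : (![1, 0] : Fin 2 → ℝ) ∈ sph 1 := mem_sph_one.2 (by simp)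
    obtain ⟨M, hM⟩ := hKcomp.bddAbove_image (continuous_lprod_dir ![1, 0]).neg.continuousOn
    have hM₀ : K ⊆ horoBallCl 1 ![1, 0] M := fun X hX => (mem_horoBallCl_one he₀).2
      ⟨hKH hX, (hM (mem_image_of_mem _ hX)).trans (by linarith [Real.add_one_le_exp M])⟩
    refine ⟨(![1, 0], M) :: (![1, 0], M) :: T.toList.map fun Z => (e Z, s Z), by simp, ?_, ?_⟩
    · intro p hp
      simp only [List.mem_cons, List.mem_map, Finset.mem_toList] at hp
      rcases hp with rfl | rfl | ⟨Z, hZT, rfl⟩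
      · exact ⟨he₀, hM₀⟩
      · exact ⟨he₀, hM₀⟩
      · exact ⟨he Z (hT Z hZT), hs Z (hT Z hZT)⟩
    · intro Z hZb
      obtain ⟨W, hW, hlt⟩ := mem_iUnion₂.1 (hcov hZb)
      exact ⟨(e W, s W), List.mem_cons_of_mem _ (List.mem_cons_of_mem _
        (List.mem_map.2 ⟨W, Finset.mem_toList.2 hW, rfl⟩)), hlt⟩
  have hexp : ∀ s, Real.exp (Real.log ρ + s) = ρ * Real.exp s := fun s => by
    rw [Real.exp_add, Real.exp_log hρ0]
  obtain ⟨P, hPdef⟩ : ∃ P : Set (Fin 3 → ℝ), P =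
      ⋂ i : Fin L.length, horoBallCl 1 (L.get i).1 (Real.log ρ + (L.get i).2) := ⟨_, rfl⟩
  have hmemP : ∀ X, X ∈ P ↔ X ∈ Hyp 1 ∧
      ∀ p ∈ L, -lprod 1 X (dir p.1) ≤ ρ * Real.exp p.2 := by
    intro X
    have hi : ∀ i : Fin L.length, X ∈ horoBallCl 1 (L.get i).1 (Real.log ρ + (L.get i).2) ↔
        X ∈ Hyp 1 ∧ -lprod 1 X (dir (L.get i).1) ≤ ρ * Real.exp (L.get i).2 := fun i => by
      rw [mem_horoBallCl_one (hL _ (L.get_mem i)).1, hexp]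
    rw [hPdef, mem_iInter]
    simp only [hi]
    refine ⟨fun h => ⟨(h ⟨0, by omega⟩).1, fun p hp => ?_⟩,
      fun h i => ⟨h.1, h.2 _ (L.get_mem i)⟩⟩
    obtain ⟨i, rfl⟩ := List.get_of_mem hp
    exact (h i).2
  have hCp : ∀ p ∈ L, -lprod 1 C (dir p.1) ≤ q * Real.exp p.2 := fun p hp =>
    hCq p.1 (hL p hp).1 p.2 (hL p hp).2
  have hPK : P ⊆ K := by
    intro X hX
    by_contra hXK
    obtain ⟨hXH, hXL⟩ := (hmemP X).1 hX
    obtain ⟨u, hu⟩ := exists_geo_mem_boundary hKc hC hXH hCK hXK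
    obtain ⟨p, hp, hlt⟩ := hLcov _ hu
    have h1 := neg_lprod_dir_geo_le hC hXH u.2.1 u.2.2 (hL p hp).1
    have h2 : -lprod 1 C (dir p.1) ≤ ρ * Real.exp p.2 :=
      (hCp p hp).trans (mul_le_mul_of_nonneg_right hqρ.le (Real.exp_pos _).le)
    have h3 := mul_le_mul_of_nonneg_left h2 (sub_nonneg.2 u.2.2)
    have h4 := mul_le_mul_of_nonneg_left (hXL p hp) u.2.1
    linarith
  have hPclosed : IsClosed P := by
    have : P = K ∩ ⋂ p ∈ L, {X : Fin 3 → ℝ | -lprod 1 X (dir p.1) ≤ ρ * Real.exp p.2} := by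
      ext X
      simp only [mem_inter_iff, mem_iInter, mem_ofPred_eq]
      exact ⟨fun h => ⟨hPK h, ((hmemP X).1 h).2⟩, fun h => (hmemP X).2 ⟨hKH h.1, h.2⟩⟩
    rw [this]
    exact hKc.inter (isClosed_biInter fun p _ =>
      isClosed_le (continuous_lprod_dir p.1).neg continuous_const)
  have hKP : K ⊆ outPar 1 P ε := by
    intro X hX
    have hXH := hKH hX
    refine ⟨hXH, geo X C t, (hmemP _).2 ⟨geo_mem_Hyp hXH hC ht0.le ht1.le, fun p hp => ?_⟩, ?_⟩
    · refine (neg_lprod_dir_geo_le hXH hC ht0.le ht1.le (hL p hp).1).trans ?_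
      have h1 := ((mem_horoBallCl_one (hL p hp).1).1 ((hL p hp).2 hX)).2
      have h3 := mul_le_mul_of_nonneg_left h1 (sub_nonneg.2 ht1.le)
      have h4 := mul_le_mul_of_nonneg_left (hCp p hp) ht0.le
      rw [hρ]
      linarith
    · refine (dH_geo_le hXH hC ht0.le ht1.le).trans (le_trans ?_ htB)
      exact mul_le_mul_of_nonneg_left (hB X hX) (by linarith)
  have hPconv : ∀ X ∈ P ∩ closure (Hyp 1 \ P),
      ∃ e ∈ sph 1, ∃ s : ℝ, P ⊆ horoBallCl 1 e s ∧ X ∈ horoSphere 1 e s := by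
    rintro X ⟨hXP, hXc⟩
    have hcl : IsClosed
        (⋃ i : Fin L.length, {Y : Fin 3 → ℝ |
          ρ * Real.exp (L.get i).2 ≤ -lprod 1 Y (dir (L.get i).1)}) :=
      isClosed_iUnion_of_finite fun i =>
        isClosed_le continuous_const (continuous_lprod_dir (L.get i).1).neg
    have hsub := closure_minimal (s := Hyp 1 \ P) (fun Y hY => by
      have h := hY.2
      rw [hmemP] at h
      push Not at h
      obtain ⟨p, hp, hlt⟩ := h hY.1
      obtain ⟨i, rfl⟩ := List.get_of_mem hp
      exact mem_iUnion.2 ⟨i, hlt.le⟩) hcl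
    obtain ⟨i, hi⟩ := mem_iUnion.1 (hsub hXc)
    have hle := ((hmemP X).1 hXP).2 _ (L.get_mem i)
    refine ⟨(L.get i).1, (hL _ (L.get_mem i)).1, Real.log ρ + (L.get i).2,
      hPdef ▸ iInter_subset _ i, ((hmemP X).1 hXP).1, ?_⟩
    rw [hexp]
    linarith [show ρ * Real.exp (L.get i).2 ≤ -lprod 1 X (dir (L.get i).1) from hi]
  have hPint : C ∈ relInt 1 P := by
    refine ⟨hC, Real.log (ρ / q), Real.log_pos ((one_lt_div hq0).2 hqρ), fun Y hY hd => ?_⟩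
    refine (hmemP Y).2 ⟨hY, fun p hp => (neg_lprod_dir_le hC hY (hL p hp).1).trans ?_⟩
    have h1 : Real.exp (dH 1 C Y) ≤ ρ / q := by
      rw [← Real.exp_log (div_pos hρ0 hq0)]
      exact Real.exp_le_exp.2 hd.le
    calc Real.exp (dH 1 C Y) * -lprod 1 C (dir p.1)
        ≤ ρ / q * (q * Real.exp p.2) := mul_le_mul h1 (hCp p hp)
          (by linarith [lprod_dir_neg hC (hL p hp).1]) (div_pos hρ0 hq0).le
      _ = ρ * Real.exp p.2 := by field_simp
  refine ⟨P, ⟨⟨⟨hPK.trans hKH, hPclosed, hPconv⟩, hKcomp.of_isClosed_subset hPclosed hPK,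
    C, hPint⟩, L.length, hL2, fun i => (L.get i).1, fun i => Real.log ρ + (L.get i).2,
    fun i => (hL _ (L.get_mem i)).1, hPdef⟩, hPK, hKP, ?_⟩
  refine csInf_le ⟨0, fun δ hδ => hδ.1⟩ ⟨hε.le, hKP, fun X hX => ?_⟩
  have hXH := hKH (hPK hX)
  exact ⟨hXH, X, hPK hX, by rw [dH_self hXH]; exact hε.le⟩

end Horo
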